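/- Let r, s > 0 and τ₀ ∈ (0,1). Then 𝒰_{r,s} ⊆ ⋃_{τ₀ < τ < 1} K_{τr,τs}^{lc,Λ}. -/

import Mathlib

noncomputable section

/-- Vectors in ℝ³. -/
abbrev V3 : Type := Fin 3 → ℝ

/-- Euclidean inner product on ℝ³. -/
def dot3 (a b : V3) : ℝ := ∑ i, a i * b i

/-- Cross product on ℝ³. -/
def cross3 (a b : V3) : V3 :=
  ![a 1 * b 2 - a 2 * b 1, a 2 * b 0 - a 0 * b 2, a 0 * b 1 - a 1 * b 0]

/-- Euclidean norm on ℝ³. -/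
def eNorm3 (a : V3) : ℝ := Real.sqrt (∑ i, (a i) ^ 2)

/-- 3×3 real matrices. -/
abbrev Mat3 : Type := Matrix (Fin 3) (Fin 3) ℝ

/-- A state is a tuple V = (u, S, B, E). -/
abbrev MHDState : Type := V3 × Mat3 × V3 × V3

/-- The Euclidean norm on the state space. -/
def stateNorm (V : MHDState) : ℝ :=
  Real.sqrt ((∑ i, (V.1 i) ^ 2) + (∑ i, ∑ j, (V.2.1 i j) ^ 2) +
    (∑ i, (V.2.2.1 i) ^ 2) + (∑ i, (V.2.2.2 i) ^ 2))

/-- ξ = (ξ_x, ξ_t) annihilates the state V = (u, S, B, E) if ξ_x·u = 0, ξ_x·B = 0,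
ξ_t u + S ξ_x = 0 and ξ_t B + ξ_x × E = 0. -/
def Annihilates (ξx : V3) (ξt : ℝ) (V : MHDState) : Prop :=
  dot3 ξx V.1 = 0 ∧ dot3 ξx V.2.2.1 = 0 ∧
  ξt • V.1 + V.2.1.mulVec ξx = 0 ∧
  ξt • V.2.2.1 + cross3 ξx V.2.2.2 = 0

/-- The wave cone Λ: states with symmetric S admitting some ξ with ξ_x ≠ 0
annihilating them. -/
def WaveCone : Set MHDState :=
  {V | V.2.1.IsSymm ∧ ∃ ξx : V3, ∃ ξt : ℝ, ξx ≠ 0 ∧ Annihilates ξx ξt V}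

/-- The set ℳ of states (with symmetric S) satisfying B·E = 0. -/
def MSet : Set MHDState :=
  {V | V.2.1.IsSymm ∧ dot3 V.2.2.1 V.2.2.2 = 0}

/-- The segment [V₀ − (1−λ)V, V₀ + λV] is a good Λ-segment. -/
def GoodSegment (V₀ V : MHDState) (lam : ℝ) : Prop :=
  V₀ ∈ MSet ∧ V ∈ WaveCone ∧ 0 < lam ∧ lam < 1 ∧
  (∀ t : ℝ, -(1 - lam) ≤ t → t ≤ lam → V₀ + t • V ∈ MSet) ∧
  ∃ ξx : V3, ∃ ξt : ℝ, ξx ≠ 0 ∧ Annihilates ξx ξt V ∧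
    ((V.2.2.1 = 0 ∧ V.2.2.2 = 0) ∨
     (dot3 ξx V₀.2.2.1 ≠ 0 ∨ ξt • V₀.2.2.1 + cross3 ξx V₀.2.2.2 ≠ 0) ∨
     (∃ k : ℝ, k ≠ -(1 / lam) ∧ k ≠ 1 / (1 - lam) ∧
       V.2.2.1 = k • V₀.2.2.1 ∧ V.2.2.2 = k • V₀.2.2.2 ∧
       ¬(V.2.2.1 = 0 ∧ V.2.2.2 = 0)) ∨
     (V.1 = 0 ∧ V.2.1 = 0 ∧ V₀.2.2.1 = 0 ∧ V₀.2.2.2 = 0))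

/-- The iterated lamination sets Y^{N,Λ}. -/
def lamHull (Y : Set MHDState) : ℕ → Set MHDState
  | 0 => Y
  | N + 1 => lamHull Y N ∪
      {Z | ∃ lam : ℝ, ∃ V W : MHDState, 0 ≤ lam ∧ lam ≤ 1 ∧
        V ∈ lamHull Y N ∧ W ∈ lamHull Y N ∧ V - W ∈ WaveCone ∧
        Z = lam • V + (1 - lam) • W}

/-- The lamination convex hull Y^{lc,Λ}. -/
def lcHull (Y : Set MHDState) : Set MHDState := ⋃ N : ℕ, lamHull Y N

/-- The iterated good lamination sets Y^{k,Λ_g}. -/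
def lamHullG (Y : Set MHDState) : ℕ → Set MHDState
  | 0 => Y
  | k + 1 => lamHullG Y k ∪
      {V₀ | ∃ lam : ℝ, ∃ V : MHDState, GoodSegment V₀ V lam ∧
        V₀ + lam • V ∈ lamHullG Y k ∧ V₀ - (1 - lam) • V ∈ lamHullG Y k}

/-- The good lamination convex hull Y^{lc,Λ_g}. -/
def lcHullG (Y : Set MHDState) : Set MHDState := ⋃ k : ℕ, lamHullG Y k

/-- A set of states is relatively open in ℳ. -/
def RelOpen (U : Set MHDState) : Prop :=
  ∀ V ∈ U, ∃ δ : ℝ, 0 < δ ∧ ∀ W ∈ MSet, stateNorm (W - V) < δ → W ∈ U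

/-- The tensor product a⊗b of two vectors in ℝ³. -/
def outer (a b : V3) : Mat3 := Matrix.of fun i j => a i * b j

/-- The constitutive set K_{r,s}. -/
def Kset (r s : ℝ) : Set MHDState :=
  {V | ∃ q : ℝ, |q| ≤ r * s ∧
    V.2.1 = outer V.1 V.1 - outer V.2.2.1 V.2.2.1 + q • (1 : Mat3) ∧
    V.2.2.2 = cross3 V.2.2.1 V.1 ∧
    eNorm3 (V.1 + V.2.2.1) = r ∧ eNorm3 (V.1 - V.2.2.1) = s}

/-- 𝒰_{r,s}: the relative interior of K_{r,s}^{lc,Λ} in ℳ. -/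
def Uset (r s : ℝ) : Set MHDState :=
  {V | V ∈ MSet ∧ ∃ δ : ℝ, 0 < δ ∧
    ∀ W ∈ MSet, stateNorm (W - V) < δ → W ∈ lcHull (Kset r s)}

/-- The Frobenius norm on 3×3 matrices. -/
def frobNorm (M : Mat3) : ℝ := Real.sqrt (∑ i, ∑ j, (M i j) ^ 2)

/-- The relatively open sets 𝒱_{r',s',c}. -/
def Vset (r' s' c : ℝ) : Set MHDState :=
  {V | V.2.1.IsSymm ∧ dot3 V.2.2.1 V.2.2.2 = 0 ∧ ∃ q : ℝ,
    eNorm3 (V.1 + V.2.2.1) < r' + c ∧ eNorm3 (V.1 - V.2.2.1) < s' + c ∧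
    frobNorm (V.2.1 - (outer V.1 V.1 - outer V.2.2.1 V.2.2.1) - q • (1 : Mat3)) < c ∧
    |q| < r' * s' + c ∧ eNorm3 (V.2.2.2 - cross3 V.2.2.1 V.1) < c}

/-- The scaling `(u, S, B, E) ↦ (c u, c² S, c B, c² E)` of states. -/
def scaleState (c : ℝ) (V : MHDState) : MHDState :=
  (c • V.1, c ^ 2 • V.2.1, c • V.2.2.1, c ^ 2 • V.2.2.2)

theorem scaleState_one (V : MHDState) : scaleState 1 V = V := by
  simp [scaleState]

theorem scaleState_scaleState (c d : ℝ) (V : MHDState) :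
    scaleState c (scaleState d V) = scaleState (c * d) V := by
  simp [scaleState, smul_smul, mul_pow]

theorem scaleState_sub (c : ℝ) (V W : MHDState) :
    scaleState c (V - W) = scaleState c V - scaleState c W := by
  simp [scaleState, smul_sub]

theorem scaleState_combination (c a b : ℝ) (V W : MHDState) :
    scaleState c (a • V + b • W) = a • scaleState c V + b • scaleState c W := by
  simp [scaleState, smul_add, smul_smul, mul_comm]

theorem dot3_smul (c d : ℝ) (a b : V3) : dot3 (c • a) (d • b) = c * d * dot3 a b := by
  simp only [dot3, Pi.smul_apply, smul_eq_mul, Finset.mul_sum]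
  exact Finset.sum_congr rfl fun i _ => by ring

theorem cross3_smul (c d : ℝ) (a b : V3) :
    cross3 (c • a) (d • b) = (c * d) • cross3 a b := by
  ext i
  fin_cases i <;> simp [cross3] <;> ring

theorem outer_smul_smul (c : ℝ) (a b : V3) : outer (c • a) (c • b) = c ^ 2 • outer a b := by
  ext i j
  simp only [outer, Matrix.of_apply, Matrix.smul_apply, Pi.smul_apply, smul_eq_mul]
  ring

theorem eNorm3_smul {c : ℝ} (hc : 0 ≤ c) (a : V3) : eNorm3 (c • a) = c * eNorm3 a := by
  simp only [eNorm3, Pi.smul_apply, smul_eq_mul, mul_pow, ← Finset.mul_sum]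
  rw [Real.sqrt_mul (sq_nonneg c), Real.sqrt_sq hc]

theorem scaleState_mem_MSet (c : ℝ) {V : MHDState} (hV : V ∈ MSet) : scaleState c V ∈ MSet :=
  ⟨hV.1.smul _, by
    change dot3 (c • V.2.2.1) (c ^ 2 • V.2.2.2) = 0
    rw [dot3_smul, hV.2, mul_zero]⟩

theorem Annihilates.scaleState {ξx : V3} {ξt : ℝ} {V : MHDState} (c : ℝ)
    (h : Annihilates ξx ξt V) : Annihilates ξx (c * ξt) (scaleState c V) := by
  obtain ⟨hu, hB, hS, hE⟩ := h
  refine ⟨?_, ?_, ?_, ?_⟩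
  · have := dot3_smul 1 c ξx V.1
    rwa [one_smul, hu, mul_zero] at this
  · have := dot3_smul 1 c ξx V.2.2.1
    rwa [one_smul, hB, mul_zero] at this
  · change (c * ξt) • c • V.1 + (c ^ 2 • V.2.1).mulVec ξx = 0
    have e : (c * ξt) • c • V.1 = c ^ 2 • ξt • V.1 := by
      simp only [smul_smul]
      congr 1
      ring
    rw [e, Matrix.smul_mulVec, ← smul_add, hS, smul_zero]
  · change (c * ξt) • c • V.2.2.1 + cross3 ξx (c ^ 2 • V.2.2.2) = 0
    have e : (c * ξt) • c • V.2.2.1 = c ^ 2 • ξt • V.2.2.1 := by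
      simp only [smul_smul]
      congr 1
      ring
    have e' := cross3_smul 1 (c ^ 2) ξx V.2.2.2
    rw [one_smul, one_mul] at e'
    rw [e, e', ← smul_add, hE, smul_zero]

theorem scaleState_mem_WaveCone (c : ℝ) {V : MHDState} (hV : V ∈ WaveCone) :
    scaleState c V ∈ WaveCone := by
  obtain ⟨hS, ξx, ξt, hξ, hA⟩ := hV
  exact ⟨hS.smul _, ξx, c * ξt, hξ, hA.scaleState c⟩

theorem scaleState_mem_Kset {c r s : ℝ} (hc : 0 ≤ c) {V : MHDState} (hV : V ∈ Kset r s) :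
    scaleState c V ∈ Kset (c * r) (c * s) := by
  obtain ⟨q, hq, hS, hE, hp, hm⟩ := hV
  refine ⟨c ^ 2 * q, ?_, ?_, ?_, ?_, ?_⟩
  · rw [abs_mul, abs_of_nonneg (sq_nonneg c)]
    calc c ^ 2 * |q| ≤ c ^ 2 * (r * s) := by gcongr
      _ = c * r * (c * s) := by ring
  · simp only [scaleState, outer_smul_smul]
    rw [hS, smul_add, smul_sub, smul_smul]
  · simp only [scaleState, cross3_smul]
    rw [hE, sq]
  · simp only [scaleState]
    rw [← smul_add, eNorm3_smul hc, hp]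
  · simp only [scaleState]
    rw [← smul_sub, eNorm3_smul hc, hm]

theorem scaleState_mem_lamHull {c : ℝ} {Y Z : Set MHDState}
    (hYZ : ∀ V ∈ Y, scaleState c V ∈ Z) (N : ℕ) :
    ∀ V ∈ lamHull Y N, scaleState c V ∈ lamHull Z N := by
  induction N with
  | zero => exact hYZ
  | succ N ih =>
    rintro X (hX | ⟨lam, V, W, hlam0, hlam1, hV, hW, hVW, rfl⟩)
    · exact Or.inl (ih X hX)
    · exact Or.inr ⟨lam, scaleState c V, scaleState c W, hlam0, hlam1, ih V hV, ih W hW,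
        scaleState_sub c V W ▸ scaleState_mem_WaveCone c hVW, scaleState_combination ..⟩

theorem scaleState_mem_lcHull_Kset {c r s : ℝ} (hc : 0 ≤ c) {V : MHDState}
    (hV : V ∈ lcHull (Kset r s)) : scaleState c V ∈ lcHull (Kset (c * r) (c * s)) := by
  obtain ⟨N, hN⟩ := Set.mem_iUnion.1 hV
  exact Set.mem_iUnion.2
    ⟨N, scaleState_mem_lamHull (fun _ h => scaleState_mem_Kset hc h) N V hN⟩

theorem continuous_stateNorm_scaleState_sub (V : MHDState) :
    Continuous fun c : ℝ => stateNorm (scaleState c V - V) := by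
  simp only [stateNorm, scaleState, Prod.fst_sub, Prod.snd_sub, Pi.sub_apply, Pi.smul_apply,
    Matrix.sub_apply, Matrix.smul_apply, smul_eq_mul]
  fun_prop

/-- 𝒰_{r,s} ⊆ ⋃_{τ₀ < τ < 1} K_{τr,τs}^{lc,Λ} for every τ₀ ∈ (0,1). -/
theorem stmt15 (r s τ₀ : ℝ) (hr : 0 < r) (hs : 0 < s)
    (h0 : 0 < τ₀) (h1 : τ₀ < 1) :
    Uset r s ⊆ ⋃ τ ∈ Set.Ioo τ₀ 1, lcHull (Kset (τ * r) (τ * s)) := by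
  rintro V ⟨hVM, δ, hδ, hV⟩
  have hlt : ∀ᶠ c in nhds (1 : ℝ), stateNorm (scaleState c V - V) < δ := by
    refine (continuous_stateNorm_scaleState_sub V).continuousAt.eventually_lt_const ?_
    simpa [scaleState_one, stateNorm] using hδ
  have hIoo : ∀ᶠ c in nhdsWithin (1 : ℝ) (Set.Ioi 1), c ∈ Set.Ioo 1 τ₀⁻¹ :=
    Ioo_mem_nhdsGT ((one_lt_inv₀ h0).2 h1)
  obtain ⟨c, hc, hc1, hcτ⟩ := ((hlt.filter_mono nhdsWithin_le_nhds).and hIoo).exists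
  have hc0 : 0 < c := one_pos.trans hc1
  have hmem := scaleState_mem_lcHull_Kset (inv_nonneg.2 hc0.le)
    (hV _ (scaleState_mem_MSet c hVM) hc)
  rw [scaleState_scaleState, inv_mul_cancel₀ hc0.ne', scaleState_one] at hmem
  exact Set.mem_iUnion₂.2 ⟨c⁻¹, ⟨(lt_inv_comm₀ hc0 h0).1 hcτ, inv_lt_one_of_one_lt₀ hc1⟩, hmem⟩
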